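/- Let Ω ⊆ ℝ³ be open and let f : Ω → ℍ be a C² function taking values in the reduced quaternions which is monogenic (∂̄f = 0). Then ∂̄(x̄f + fx̄)∂̄ = 4∂̄f₀, where x̄ = x₀ − x₁e₁ − x₂e₂ denotes the quaternionic conjugate of the variable x = x₀ + x₁e₁ + x₂e₂, f₀ is the scalar part of f, and ∂̄f₀ = ∂₀f₀ + e₁(∂₁f₀) + e₂(∂₂f₀). -/

import Mathlib

open Quaternion

noncomputable section

abbrev R3 := Fin 3 → ℝ

/-- Partial derivative `∂ᵢ` in the coordinate direction `i`. -/
noncomputable def pd {E : Type*} [NormedAddCommGroup E] [NormedSpace ℝ E]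
    (i : Fin 3) (f : R3 → E) (x : R3) : E :=
  fderiv ℝ f x (Pi.single i 1)

/-- The quaternion unit `e₁`. -/
def e1 : ℍ[ℝ] := ⟨0,1,0,0⟩
/-- The quaternion unit `e₂`. -/
def e2 : ℍ[ℝ] := ⟨0,0,1,0⟩
/-- The quaternion unit `e₃`. -/
def e3 : ℍ[ℝ] := ⟨0,0,0,1⟩

/-- The units `e₀ = 1, e₁, e₂`. -/
def eu : Fin 3 → ℍ[ℝ] := ![1, e1, e2]
/-- The signs `ε₀ = 1, ε₁ = ε₂ = −1`. -/
def eps : Fin 3 → ℝ := ![1, -1, -1]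

/-- The two-sided operator `∂̄f∂̄ = Σᵢⱼ eᵢ(∂ᵢ∂ⱼf)eⱼ`. -/
noncomputable def sandwichBar (f : R3 → ℍ[ℝ]) (x : R3) : ℍ[ℝ] :=
  ∑ i : Fin 3, ∑ j : Fin 3, eu i * pd i (pd j f) x * eu j

/-- The two-sided operator `∂f∂ = Σᵢⱼ εᵢεⱼ eᵢ(∂ᵢ∂ⱼf)eⱼ`. -/
noncomputable def sandwich (f : R3 → ℍ[ℝ]) (x : R3) : ℍ[ℝ] :=
  ∑ i : Fin 3, ∑ j : Fin 3, (eps i * eps j) • (eu i * pd i (pd j f) x * eu j)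

/-- The Laplacian `Δ = ∂₀² + ∂₁² + ∂₂²`. -/
noncomputable def lap {E : Type*} [NormedAddCommGroup E] [NormedSpace ℝ E]
    (f : R3 → E) (x : R3) : E :=
  pd 0 (pd 0 f) x + pd 1 (pd 1 f) x + pd 2 (pd 2 f) x

/-- The left Cauchy–Riemann operator `∂̄f = ∂₀f + e₁(∂₁f) + e₂(∂₂f)`. -/
noncomputable def DbarL (f : R3 → ℍ[ℝ]) (x : R3) : ℍ[ℝ] :=
  pd 0 f x + e1 * pd 1 f x + e2 * pd 2 f x

/-- The left conjugate Cauchy–Riemann operator `∂f = ∂₀f − e₁(∂₁f) − e₂(∂₂f)`. -/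
noncomputable def DL (f : R3 → ℍ[ℝ]) (x : R3) : ℍ[ℝ] :=
  pd 0 f x - e1 * pd 1 f x - e2 * pd 2 f x

/-- The right Cauchy–Riemann operator `f∂̄ = ∂₀f + (∂₁f)e₁ + (∂₂f)e₂`. -/
noncomputable def DbarR (f : R3 → ℍ[ℝ]) (x : R3) : ℍ[ℝ] :=
  pd 0 f x + pd 1 f x * e1 + pd 2 f x * e2

/-- The right conjugate Cauchy–Riemann operator `f∂ = ∂₀f − (∂₁f)e₁ − (∂₂f)e₂`. -/
noncomputable def DR (f : R3 → ℍ[ℝ]) (x : R3) : ℍ[ℝ] :=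
  pd 0 f x - pd 1 f x * e1 - pd 2 f x * e2

/-- The quaternionic conjugate `x̄ = x₀ − x₁e₁ − x₂e₂` of the variable
`x = x₀ + x₁e₁ + x₂e₂`. -/
def xbar (y : R3) : ℍ[ℝ] := ⟨y 0, -(y 1), -(y 2), 0⟩

lemma HasFDerivAt.pd_eq {E : Type*} [NormedAddCommGroup E] [NormedSpace ℝ E] {i : Fin 3}
    {f : R3 → E} {f' : R3 →L[ℝ] E} {x : R3} (h : HasFDerivAt f f' x) :
    pd i f x = f' (Pi.single i 1) := by
  rw [pd, h.fderiv]

section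

variable {E F : Type*} [NormedAddCommGroup E] [NormedSpace ℝ E]
  [NormedAddCommGroup F] [NormedSpace ℝ F]

lemma pd_congr {i : Fin 3} {f g : R3 → E} {x : R3} (h : f =ᶠ[nhds x] g) :
    pd i f x = pd i g x := by
  rw [pd, pd, h.fderiv_eq]

lemma pd_clm_comp (L : E →L[ℝ] F) {i : Fin 3} {f : R3 → E} {x : R3}
    (hf : DifferentiableAt ℝ f x) : pd i (fun y => L (f y)) x = L (pd i f x) :=
  (L.hasFDerivAt.comp x hf.hasFDerivAt).pd_eq

lemma pd_add {i : Fin 3} {f g : R3 → E} {x : R3}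
    (hf : DifferentiableAt ℝ f x) (hg : DifferentiableAt ℝ g x) :
    pd i (fun y => f y + g y) x = pd i f x + pd i g x :=
  (hf.hasFDerivAt.add hg.hasFDerivAt).pd_eq

lemma pd_const (i : Fin 3) (c : E) (x : R3) : pd i (fun _ => c) x = 0 :=
  (hasFDerivAt_const c x).pd_eq

lemma ContDiffAt.differentiableAt_pd {f : R3 → E} {x : R3} (hf : ContDiffAt ℝ 2 f x)
    (i : Fin 3) : DifferentiableAt ℝ (pd i f) x :=
  ((hf.fderiv_right (m := 1) (by norm_num)).differentiableAt (by norm_num)).clm_apply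
    (differentiableAt_const _)

lemma ContDiffAt.pd_comm {f : R3 → E} {x : R3} (hf : ContDiffAt ℝ 2 f x) (i j : Fin 3) :
    pd i (pd j f) x = pd j (pd i f) x := by
  have hd := (hf.fderiv_right (m := 1) (by norm_num)).differentiableAt (by norm_num)
  have key (k l : Fin 3) :
      pd k (pd l f) x = fderiv ℝ (fderiv ℝ f) x (Pi.single k 1) (Pi.single l 1) := by
    have h := hd.hasFDerivAt.clm_apply (hasFDerivAt_const (Pi.single l (1 : ℝ) : R3) x)
    exact h.pd_eq.trans (by simp)
  rw [key, key]
  exact hf.isSymmSndFDerivAt (by simp) _ _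

end

lemma pd_mul {i : Fin 3} {f g : R3 → ℍ[ℝ]} {x : R3}
    (hf : DifferentiableAt ℝ f x) (hg : DifferentiableAt ℝ g x) :
    pd i (fun y => f y * g y) x = f x * pd i g x + pd i f x * g x :=
  (hf.hasFDerivAt.mul' hg.hasFDerivAt).pd_eq

/-- The scalar part as a continuous real-linear functional. -/
def reCLM : ℍ[ℝ] →L[ℝ] ℝ where
  toFun := fun q => q.re
  map_add' := by simp
  map_smul' := by simp
  cont := Quaternion.continuous_re

/-- The `e₃`-component as a continuous real-linear functional. -/
def imKCLM : ℍ[ℝ] →L[ℝ] ℝ where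
  toFun := fun q => q.imK
  map_add' := by simp
  map_smul' := by simp
  cont := Quaternion.continuous_imK

@[simp] lemma e1_re : e1.re = 0 := rfl
@[simp] lemma e1_imI : e1.imI = 1 := rfl
@[simp] lemma e1_imJ : e1.imJ = 0 := rfl
@[simp] lemma e1_imK : e1.imK = 0 := rfl
@[simp] lemma e2_re : e2.re = 0 := rfl
@[simp] lemma e2_imI : e2.imI = 0 := rfl
@[simp] lemma e2_imJ : e2.imJ = 1 := rfl
@[simp] lemma e2_imK : e2.imK = 0 := rfl
@[simp] lemma xbar_re (y : R3) : (xbar y).re = y 0 := rfl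
@[simp] lemma xbar_imI (y : R3) : (xbar y).imI = -(y 1) := rfl
@[simp] lemma xbar_imJ (y : R3) : (xbar y).imJ = -(y 2) := rfl
@[simp] lemma xbar_imK (y : R3) : (xbar y).imK = 0 := rfl

/-- The conjugate variable `xbar` as a continuous linear map. -/
def xbarCLM : R3 →L[ℝ] ℍ[ℝ] :=
  LinearMap.toContinuousLinearMap
    { toFun := xbar
      map_add' := fun x y => by ext <;> simp <;> ring
      map_smul' := fun c x => by ext <;> simp }

lemma hasFDerivAt_xbar (x : R3) : HasFDerivAt xbar xbarCLM x := xbarCLM.hasFDerivAt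

lemma pd_xbar (i : Fin 3) (x : R3) : pd i xbar x = xbar (Pi.single i 1) :=
  (hasFDerivAt_xbar x).pd_eq

lemma pd_pd_xbar_mul_add {f : R3 → ℍ[ℝ]} {x : R3} (hf : ContDiffAt ℝ 2 f x) (i j : Fin 3) :
    pd i (pd j fun y => xbar y * f y + f y * xbar y) x =
      xbar x * pd i (pd j f) x + xbar (Pi.single i 1) * pd j f x +
        xbar (Pi.single j 1) * pd i f x +
      (pd i (pd j f) x * xbar x + pd j f x * xbar (Pi.single i 1) +
        pd i f x * xbar (Pi.single j 1)) := by
  have hx (y : R3) : DifferentiableAt ℝ xbar y := (hasFDerivAt_xbar y).differentiableAt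
  have hfx := hf.differentiableAt (by norm_num)
  have hpd := hf.differentiableAt_pd j
  have hev : (pd j fun y => xbar y * f y + f y * xbar y) =ᶠ[nhds x] fun y =>
      (xbar y * pd j f y + xbar (Pi.single j 1) * f y) +
        (f y * xbar (Pi.single j 1) + pd j f y * xbar y) := by
    filter_upwards [hf.eventually (by simp)] with y hy
    have hfy := hy.differentiableAt (by norm_num)
    have hxy := hx y
    rw [pd_add, pd_mul hxy hfy, pd_mul hfy hxy, pd_xbar] <;> fun_prop
  have hc : DifferentiableAt ℝ (fun _ : R3 => xbar (Pi.single j 1)) x := differentiableAt_const _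
  have hxx := hx x
  rw [pd_congr hev, pd_add, pd_add, pd_add, pd_mul hxx hpd, pd_mul hc hfx, pd_mul hfx hc,
    pd_mul hpd hxx, pd_const, pd_xbar]
  · simp only [zero_mul, mul_zero]
    abel
  all_goals fun_prop

lemma pd_DbarL {f : R3 → ℍ[ℝ]} {x : R3} (hf : ContDiffAt ℝ 2 f x) (i : Fin 3) :
    pd i (DbarL f) x = pd i (pd 0 f) x + e1 * pd i (pd 1 f) x + e2 * pd i (pd 2 f) x := by
  have h := hf.differentiableAt_pd
  have hc (c : ℍ[ℝ]) : DifferentiableAt ℝ (fun _ : R3 => c) x := differentiableAt_const _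
  unfold DbarL
  have h0 := h 0
  have h1 := h 1
  have h2 := h 2
  rw [pd_add, pd_add, pd_mul (hc e1) h1, pd_mul (hc e2) h2, pd_const, pd_const]
  · simp
  all_goals fun_prop

lemma imK_pd_eq_zero {f : R3 → ℍ[ℝ]} {x : R3} (hf : DifferentiableAt ℝ f x)
    (h : ∀ᶠ y in nhds x, (f y).imK = 0) (i : Fin 3) : (pd i f x).imK = 0 := by
  have := pd_congr (i := i) (show (fun y => imKCLM (f y)) =ᶠ[nhds x] fun _ => 0 from h)
  rw [pd_clm_comp imKCLM hf, pd_const] at this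
  exact this

lemma pd_coe_re {f : R3 → ℍ[ℝ]} {x : R3} (hf : DifferentiableAt ℝ f x) (i : Fin 3) :
    pd i (fun y => (((f y).re : ℝ) : ℍ[ℝ])) x = (((pd i f x).re : ℝ) : ℍ[ℝ]) :=
  pd_clm_comp ((algebraMapCLM ℝ ℍ[ℝ]).comp reCLM) hf

/-- for a C² monogenic reduced-quaternion-valued `f`,
`∂̄(x̄f + fx̄)∂̄ = 4∂̄f₀` where `f₀` is the scalar part of `f`. -/
theorem stmt7 (Ω : Set R3) (hΩ : IsOpen Ω) (f : R3 → ℍ[ℝ])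
    (hf : ContDiffOn ℝ 2 f Ω)
    (hred : ∀ x ∈ Ω, (f x).imK = 0)
    (hmono : ∀ x ∈ Ω, DbarL f x = 0) :
    ∀ x ∈ Ω,
      sandwichBar (fun y => xbar y * f y + f y * xbar y) x
        = 4 * DbarL (fun y => (((f y).re : ℝ) : ℍ[ℝ])) x := by
  intro x hx
  have hC (y : R3) (hy : y ∈ Ω) : ContDiffAt ℝ 2 f y := hf.contDiffAt (hΩ.mem_nhds hy)
  have hD (y : R3) (hy : y ∈ Ω) : DifferentiableAt ℝ f y :=
    (hC y hy).differentiableAt (by norm_num)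
  have hK (y : R3) (hy : y ∈ Ω) (i : Fin 3) : (pd i f y).imK = 0 :=
    imK_pd_eq_zero (hD y hy) (Filter.eventually_of_mem (hΩ.mem_nhds hy) hred) i
  have hKK (i j : Fin 3) : (pd i (pd j f) x).imK = 0 :=
    imK_pd_eq_zero ((hC x hx).differentiableAt_pd j)
      (Filter.eventually_of_mem (hΩ.mem_nhds hx) fun y hy => hK y hy j) i
  have hM (i : Fin 3) :
      pd i (pd 0 f) x + e1 * pd i (pd 1 f) x + e2 * pd i (pd 2 f) x = 0 := by
    rw [← pd_DbarL (hC x hx), ← pd_const i (0 : ℍ[ℝ]) x]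
    exact pd_congr (Filter.eventually_of_mem (hΩ.mem_nhds hx) hmono)
  have hm := hmono x hx
  have hK0 := hK x hx 0
  have hK1 := hK x hx 1
  have hK2 := hK x hx 2
  have h10 := (hC x hx).pd_comm 1 0
  have h20 := (hC x hx).pd_comm 2 0
  have h21 := (hC x hx).pd_comm 2 1
  have hM0 := hM 0
  have hM1 := hM 1
  have hM2 := hM 2
  have hK00 := hKK 0 0
  have hK01 := hKK 0 1
  have hK02 := hKK 0 2
  have hK11 := hKK 1 1
  have hK12 := hKK 1 2
  have hK22 := hKK 2 2
  simp only [sandwichBar, Fin.sum_univ_three, pd_pd_xbar_mul_add (hC x hx)]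
  simp only [DbarL, pd_coe_re (hD x hx)] at hm ⊢
  rw [h10, h20, h21]
  rw [h10] at hM1
  rw [h20, h21] at hM2
  generalize pd 0 (pd 0 f) x = a00 at *
  generalize pd 0 (pd 1 f) x = a01 at *
  generalize pd 0 (pd 2 f) x = a02 at *
  generalize pd 1 (pd 1 f) x = a11 at *
  generalize pd 1 (pd 2 f) x = a12 at *
  generalize pd 2 (pd 2 f) x = a22 at *
  generalize pd 0 f x = d0 at *
  generalize pd 1 f x = d1 at *
  generalize pd 2 f x = d2 at *
  clear h10 h20 h21 hM hKK hK hD hC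
  rw [Quaternion.ext_iff] at hM0 hM1 hM2 hm
  simp [hK0, hK1, hK2, hK00, hK01, hK02, hK11, hK12, hK22] at hM0 hM1 hM2 hm
  obtain ⟨p0, p1, p2, p3⟩ := hM0
  obtain ⟨q0, q1, q2, q3⟩ := hM1
  obtain ⟨r0, r1, r2, r3⟩ := hM2
  obtain ⟨s0, s1, s2, s3⟩ := hm
  have h4 : (4 : ℍ[ℝ]) = ((4 : ℝ) : ℍ[ℝ]) := rfl
  rw [h4]
  ext <;> simp [eu, hK0, hK1, hK2, hK00, hK01, hK02, hK11, hK12, hK22] <;> grind
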